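/- Let {σ^(k)}_{k=1,...,n} be n spin configurations in {−1,+1}^p, let u ∈ V be a node of an Ising model with zero magnetic field on p spins with maximum degree d and maximum coupling intensity β, and let S_n be the Interaction Screening Objective at node u. Then for every Δ_u ∈ ℝ^{p−1}, the remainder of the first-order Taylor expansion satisfies δS_n(Δ_u, θ*_u) ≥ (e^{−βd} / (2 + ‖Δ_u‖₁)) · Δ_uᵀ H^n Δ_u, where H^n is the empirical matrix with entries H^n_ij = (1/n)∑_{k=1}^n σ_i^(k) σ_j^(k) for i, j ≠ u. -/

import Mathlib

open scoped BigOperators Classical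

noncomputable section

/-- The ±1 spin value associated to a Boolean. -/
def spin (b : Bool) : ℝ := if b then 1 else -1

/-- The energy term of the zero-field Ising model with (symmetric, zero-diagonal)
couplings `θ`: the sum over undirected edges of `θ i j * σ_i * σ_j`. -/
def ham {p : ℕ} (θ : Fin p → Fin p → ℝ) (σ : Fin p → Bool) : ℝ :=
  (1 / 2) * ∑ i, ∑ j, θ i j * spin (σ i) * spin (σ j)

/-- The Gibbs probability `μ(σ) = exp(ham θ σ) / Z`. -/
def gibbs {p : ℕ} (θ : Fin p → Fin p → ℝ) (σ : Fin p → Bool) : ℝ :=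
  Real.exp (ham θ σ) / ∑ τ : Fin p → Bool, Real.exp (ham θ τ)

/-- Probability of the event `P` under `n` i.i.d. samples from the Ising model. -/
def probn {p : ℕ} (θ : Fin p → Fin p → ℝ) (n : ℕ)
    (P : (Fin n → Fin p → Bool) → Prop) : ℝ :=
  ∑ σs : Fin n → Fin p → Bool, if P σs then ∏ k, gibbs θ (σs k) else 0

/-- The Interaction Screening Objective at node `u`. -/
def ISO {p : ℕ} (n : ℕ) (σs : Fin n → Fin p → Bool) (u : Fin p) (θu : Fin p → ℝ) : ℝ :=
  (1 / n : ℝ) *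
    ∑ k, Real.exp (-∑ i ∈ Finset.univ.erase u, θu i * spin (σs k u) * spin (σs k i))

/-- The gradient (vector of partial derivatives) of the Interaction Screening Objective. -/
def gradISO {p : ℕ} (n : ℕ) (σs : Fin n → Fin p → Bool) (u : Fin p) (θu : Fin p → ℝ)
    (l : Fin p) : ℝ :=
  (1 / n : ℝ) *
    ∑ k, (-(spin (σs k u) * spin (σs k l))) *
      Real.exp (-∑ i ∈ Finset.univ.erase u, θu i * spin (σs k u) * spin (σs k i))

/-- ℓ₁-norm of a coupling vector around node `u` (the `u`-entry is excluded). -/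
def l1 {p : ℕ} (u : Fin p) (x : Fin p → ℝ) : ℝ := ∑ i ∈ Finset.univ.erase u, |x i|

/-- ℓ₂-norm of a coupling vector around node `u` (the `u`-entry is excluded). -/
def l2 {p : ℕ} (u : Fin p) (x : Fin p → ℝ) : ℝ :=
  Real.sqrt (∑ i ∈ Finset.univ.erase u, x i ^ 2)

theorem scalar_pos (z : ℝ) (hz : 0 ≤ z) : 0 ≤ (2 + z) * Real.exp (-z) - 2 + z := by
  have hd : ∀ x : ℝ, HasDerivAt (fun z : ℝ => (2 + z) * Real.exp (-z) - 2 + z)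
      (1 - (1 + x) * Real.exp (-x)) x := by
    intro x
    have h1 : HasDerivAt (fun z : ℝ => 2 + z) 1 x := (hasDerivAt_id x).const_add 2
    have h2 : HasDerivAt (fun z : ℝ => Real.exp (-z)) (Real.exp (-x) * (-1)) x :=
      (hasDerivAt_neg x).exp
    have h3 := ((h1.mul h2).sub_const 2).add (hasDerivAt_id x)
    refine h3.congr_deriv ?_
    ring
  have hm : Monotone (fun z : ℝ => (2 + z) * Real.exp (-z) - 2 + z) := by
    refine monotone_of_deriv_nonneg (fun x => (hd x).differentiableAt) (fun x => ?_)
    rw [(hd x).deriv]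
    have h1 := Real.add_one_le_exp x
    have h2 : Real.exp x * Real.exp (-x) = 1 := by rw [← Real.exp_add]; simp
    nlinarith [Real.exp_pos (-x)]
  have := hm hz
  simpa using this

theorem scalar_ineq (z : ℝ) : z ^ 2 / (2 + |z|) ≤ Real.exp (-z) - 1 + z := by
  have h0 := abs_nonneg z
  rw [div_le_iff₀ (by linarith)]
  rcases le_total 0 z with hz | hz
  · rw [abs_of_nonneg hz]
    nlinarith [scalar_pos z hz]
  · rw [abs_of_nonpos hz]
    have h := Real.quadratic_le_exp_of_nonneg (x := -z) (by linarith)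
    have h2 : z ^ 2 / 2 ≤ Real.exp (-z) - 1 + z := by nlinarith
    nlinarith [sq_nonneg z]

theorem spin_sq (b : Bool) : spin b * spin b = 1 := by
  cases b <;> simp [spin]

theorem abs_spin (b : Bool) : |spin b| = 1 := by
  cases b <;> simp [spin]

/-- **Lemma 5 (quadratic lower bound on the ISO Taylor remainder).**
For any `n` spin configurations, any node `u` of a zero-field Ising model with maximum
degree `d` and maximum coupling intensity `β`, and any `Δ_u ∈ ℝ^{p-1}`, the remainder of the
first-order Taylor expansion of the ISO satisfies
`δS_n(Δ_u, θ*_u) ≥ (e^{-βd} / (2 + ‖Δ_u‖₁)) Δ_uᵀ Hⁿ Δ_u`,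
where `Hⁿ_ij = (1/n) ∑_k σ_i^(k) σ_j^(k)`. -/
theorem stmt9 {p : ℕ} (n d : ℕ) (β : ℝ) (θ : Fin p → Fin p → ℝ)
    (hsymm : ∀ i j, θ i j = θ j i) (hdiag : ∀ i, θ i i = 0)
    (hdeg : ∀ i, (Finset.univ.filter fun j => θ i j ≠ 0).card ≤ d)
    (hβ : ∀ i j, |θ i j| ≤ β)
    (σs : Fin n → Fin p → Bool) (u : Fin p) (Δ : Fin p → ℝ) :
    ISO n σs u (fun i => θ u i + Δ i) - ISO n σs u (fun i => θ u i) -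
        ∑ l ∈ Finset.univ.erase u, gradISO n σs u (fun i => θ u i) l * Δ l ≥
      Real.exp (-(β * d)) / (2 + l1 u Δ) *
        ∑ i ∈ Finset.univ.erase u, ∑ j ∈ Finset.univ.erase u,
          Δ i * ((1 / n : ℝ) * ∑ k, spin (σs k i) * spin (σs k j)) * Δ j := by
  have hβ0 : 0 ≤ β := (abs_nonneg _).trans (hβ u u)
  set E := Finset.univ.erase u with hE
  set a : Fin n → ℝ := fun k => ∑ i ∈ E, θ u i * spin (σs k u) * spin (σs k i) with ha
  set x : Fin n → ℝ := fun k => ∑ i ∈ E, Δ i * spin (σs k u) * spin (σs k i) with hx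
  have hL : ISO n σs u (fun i => θ u i + Δ i) - ISO n σs u (fun i => θ u i) -
        ∑ l ∈ E, gradISO n σs u (fun i => θ u i) l * Δ l =
      (1 / n : ℝ) * ∑ k, Real.exp (-a k) * (Real.exp (-x k) - 1 + x k) := by
    have h1 : ISO n σs u (fun i => θ u i + Δ i) =
        (1 / n : ℝ) * ∑ k, Real.exp (-a k) * Real.exp (-x k) := by
      unfold ISO
      congr 1
      refine Finset.sum_congr rfl fun k _ => ?_
      rw [← Real.exp_add]
      congr 1
      rw [ha, hx, ← neg_add, ← Finset.sum_add_distrib]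
      congr 1
      exact Finset.sum_congr rfl fun i _ => by ring
    have h2 : ∑ l ∈ E, gradISO n σs u (fun i => θ u i) l * Δ l =
        (1 / n : ℝ) * ∑ k, -(Real.exp (-a k) * x k) := by
      have : ∀ l, gradISO n σs u (fun i => θ u i) l * Δ l = (1 / n : ℝ) * ∑ k,
          -(Real.exp (-a k) * (Δ l * spin (σs k u) * spin (σs k l))) := by
        intro l
        unfold gradISO
        rw [mul_assoc, Finset.sum_mul]
        congr 1
        refine Finset.sum_congr rfl fun k _ => ?_
        simp only [ha]
        ring
      simp only [this]
      rw [← Finset.mul_sum, Finset.sum_comm]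
      congr 1
      refine Finset.sum_congr rfl fun k _ => ?_
      simp only [hx]
      rw [Finset.sum_neg_distrib, Finset.mul_sum]
    have h3 : ISO n σs u (fun i => θ u i) = (1 / n : ℝ) * ∑ k, Real.exp (-a k) := rfl
    rw [h1, h2, h3, ← mul_sub, ← mul_sub, ← Finset.sum_sub_distrib, ← Finset.sum_sub_distrib]
    congr 1
    exact Finset.sum_congr rfl fun k _ => by ring
  have hR : ∑ i ∈ E, ∑ j ∈ E, Δ i * ((1 / n : ℝ) * ∑ k, spin (σs k i) * spin (σs k j)) * Δ j =
      (1 / n : ℝ) * ∑ k, x k ^ 2 := by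
    have h1 : ∀ k, x k ^ 2 = ∑ i ∈ E, ∑ j ∈ E,
        Δ i * (spin (σs k i) * spin (σs k j)) * Δ j := by
      intro k
      rw [sq, hx, Finset.sum_mul_sum]
      refine Finset.sum_congr rfl fun i _ => Finset.sum_congr rfl fun j _ => ?_
      linear_combination (Δ i * spin (σs k i) * spin (σs k j) * Δ j) * spin_sq (σs k u)
    simp only [h1]
    rw [Finset.sum_comm (s := (Finset.univ : Finset (Fin n))), Finset.mul_sum]
    refine Finset.sum_congr rfl fun i _ => ?_
    rw [Finset.sum_comm (s := (Finset.univ : Finset (Fin n))), Finset.mul_sum]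
    refine Finset.sum_congr rfl fun j _ => ?_
    rw [← Finset.sum_mul, ← Finset.mul_sum]
    ring
  rw [hL, hR, ge_iff_le, mul_left_comm, Finset.mul_sum]
  refine mul_le_mul_of_nonneg_left (Finset.sum_le_sum fun k _ => ?_) (by positivity)
  have hxk : |x k| ≤ l1 u Δ := by
    refine (Finset.abs_sum_le_sum_abs _ _).trans (Finset.sum_le_sum fun i _ => ?_)
    rw [abs_mul, abs_mul, abs_spin, abs_spin, mul_one, mul_one]
  have hak : a k ≤ β * d := by
    have h1 : a k ≤ ∑ i, |θ u i| := by
      refine (le_abs_self _).trans ((Finset.abs_sum_le_sum_abs _ _).trans ?_)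
      refine le_trans (Finset.sum_le_sum (g := fun i => |θ u i|) fun i _ => ?_)
        (Finset.sum_le_sum_of_subset_of_nonneg (Finset.subset_univ _) fun i _ _ => abs_nonneg _)
      rw [abs_mul, abs_mul, abs_spin, abs_spin, mul_one, mul_one]
    have h2 : ∑ i, |θ u i| = ∑ i ∈ Finset.univ.filter (fun j => θ u j ≠ 0), |θ u i| := by
      symm
      refine Finset.sum_subset (Finset.subset_univ _) fun i _ hi => ?_
      simpa using hi
    have h3 := Finset.sum_le_card_nsmul (Finset.univ.filter (fun j => θ u j ≠ 0))
      (fun i => |θ u i|) β (fun i _ => hβ u i)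
    rw [nsmul_eq_mul] at h3
    have h4 : (((Finset.univ.filter (fun j => θ u j ≠ 0)).card : ℕ) : ℝ) ≤ d := by
      exact_mod_cast hdeg u
    nlinarith
  have h0 := abs_nonneg (x k)
  have hs := scalar_ineq (x k)
  have hs2 : x k ^ 2 / (2 + l1 u Δ) ≤ x k ^ 2 / (2 + |x k|) := by gcongr
  have hs3 : 0 ≤ x k ^ 2 / (2 + l1 u Δ) := div_nonneg (sq_nonneg _) (by linarith)
  calc Real.exp (-(β * d)) / (2 + l1 u Δ) * x k ^ 2
      = Real.exp (-(β * d)) * (x k ^ 2 / (2 + l1 u Δ)) := by ring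
    _ ≤ Real.exp (-a k) * (Real.exp (-x k) - 1 + x k) :=
      mul_le_mul (Real.exp_le_exp.2 (by linarith)) (hs2.trans hs) hs3 (Real.exp_pos _).le
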